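/- arXiv:1407.5611 — 8 statements merged into one kernel-verified Lean document; each statement's English description precedes it below -/
import Mathlib

section
/- Let x* be a minimizer of Φ = F + J. Assume: (i) −∇F(x*) lies in the relative interior of the subdifferential ∂J(x*); (ii) there exists α > 0 such that ⟨h, ∇²F(x*) h⟩ ≥ α‖h‖² for every h in the subspace T, where T is the orthogonal complement of the linear subspace parallel to the affine hull of ∂J(x*). Then x* is the unique minimizer of Φ, i.e., every minimizer of Φ equals x*. -/
open scoped RealInnerProductSpace
open Set

noncomputable section

/-- The subdifferential of a convex function `J` at `x`. -/
def subdiff {n : ℕ} (J : EuclideanSpace ℝ (Fin n) → ℝ) (x : EuclideanSpace ℝ (Fin n)) :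
    Set (EuclideanSpace ℝ (Fin n)) :=
  {u | ∀ z, J z ≥ J x + ⟪u, z - x⟫}

/-- Moving a little from a point of the intrinsic interior in a direction of the affine span
stays in the set. -/
theorem exists_pos_add_smul_mem_of_mem_intrinsicInterior {E : Type*} [NormedAddCommGroup E]
    [NormedSpace ℝ E] {s : Set E} {u d : E} (hu : u ∈ intrinsicInterior ℝ s)
    (hd : d ∈ (affineSpan ℝ s).direction) : ∃ ε > (0 : ℝ), ε • d + u ∈ s := by
  obtain ⟨y, hy, rfl⟩ := mem_intrinsicInterior.1 hu
  let γ : ℝ → affineSpan ℝ s := fun t =>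
    ⟨t • d + (y : E), AffineSubspace.vadd_mem_of_mem_direction
      (Submodule.smul_mem _ t hd) y.2⟩
  have hγ : Continuous γ := by
    refine Continuous.subtype_mk ?_ _
    fun_prop
  have hγ0 : γ 0 = y := by ext; simp [γ]
  have hmem : γ ⁻¹' interior ((↑) ⁻¹' s) ∈ nhds (0 : ℝ) :=
    (isOpen_interior.preimage hγ).mem_nhds (by simpa [hγ0] using hy)
  obtain ⟨ε, hε, hball⟩ := Metric.mem_nhds_iff.1 hmem
  refine ⟨ε / 2, half_pos hε, ?_⟩
  have hin : ε / 2 ∈ Metric.ball (0 : ℝ) ε := by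
    rw [mem_ball_zero_iff, Real.norm_of_nonneg (half_pos hε).le]
    exact half_lt_self hε
  have hγε : γ (ε / 2) ∈ ((↑) ⁻¹' s : Set (affineSpan ℝ s)) := interior_subset (hball hin)
  exact hγε

theorem hasDerivAt_comp_add_smul {E : Type*} [NormedAddCommGroup E] [InnerProductSpace ℝ E]
    [CompleteSpace E] {F : E → ℝ} (hF : Differentiable ℝ F) (x h : E) (t : ℝ) :
    HasDerivAt (fun t : ℝ => F (x + t • h)) ⟪gradient F (x + t • h), h⟫ t := by
  have hline : HasDerivAt (fun t : ℝ => x + t • h) h t := by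
    simpa using ((hasDerivAt_id t).smul_const h).const_add x
  have := (hF (x + t • h)).hasGradientAt.hasFDerivAt.comp_hasDerivAt t hline
  simpa [Function.comp_def] using this

/-- If a differentiable function is affine on the segment from `x` to `x + h`, then its Hessian
at `x`, when it exists, vanishes on `h`. -/
theorem inner_fderiv_gradient_eq_zero {E : Type*} [NormedAddCommGroup E]
    [InnerProductSpace ℝ E] [CompleteSpace E] {F : E → ℝ} (hF : Differentiable ℝ F) {x h : E}
    (hF2 : DifferentiableAt ℝ (gradient F) x)
    (haff : ∀ t ∈ Ioo (0 : ℝ) 1, F (x + t • h) = F x + t * ⟪gradient F x, h⟫) :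
    ⟪h, fderiv ℝ (gradient F) x h⟫ = 0 := by
  have hgrad : ∀ t ∈ Ioo (0 : ℝ) 1, ⟪h, gradient F (x + t • h)⟫ = ⟪gradient F x, h⟫ := by
    intro t ht
    rw [real_inner_comm]
    refine (hasDerivAt_comp_add_smul hF x h t).unique (HasDerivAt.congr_of_eventuallyEq
      (f := fun s => F x + s * ⟪gradient F x, h⟫) ?_ ?_)
    · simpa using ((hasDerivAt_id t).mul_const ⟪gradient F x, h⟫).const_add (F x)
    · filter_upwards [isOpen_Ioo.mem_nhds ht] with s hs using haff s hs
  have hline : HasDerivAt (fun t : ℝ => x + t • h) h 0 := by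
    simpa using ((hasDerivAt_id (0 : ℝ)).smul_const h).const_add x
  have hcomp : HasDerivAt (fun t : ℝ => gradient F (x + t • h))
      (fderiv ℝ (gradient F) x h) 0 := by
    have hx : HasFDerivAt (gradient F) (fderiv ℝ (gradient F) x) (x + (0 : ℝ) • h) := by
      simpa using hF2.hasFDerivAt
    exact hx.comp_hasDerivAt (0 : ℝ) hline
  have hinner : HasDerivAt (fun t : ℝ => ⟪h, gradient F (x + t • h)⟫)
      ⟪h, fderiv ℝ (gradient F) x h⟫ 0 := by
    simpa using (hasDerivAt_const (0 : ℝ) h).inner ℝ hcomp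
  have hconst : HasDerivWithinAt (fun t : ℝ => ⟪h, gradient F (x + t • h)⟫) 0 (Ioi 0) 0 := by
    refine (hasDerivWithinAt_const (0 : ℝ) (Ioi 0) ⟪gradient F x, h⟫).congr_of_eventuallyEq ?_ ?_
    · filter_upwards [Ioo_mem_nhdsGT (zero_lt_one' ℝ)] with t ht using hgrad t ht
    · simp
  exact (uniqueDiffWithinAt_Ioi 0).eq_deriv _ hinner.hasDerivWithinAt hconst

theorem ConvexOn.add_mul_inner_gradient_le {E : Type*} [NormedAddCommGroup E]
    [InnerProductSpace ℝ E] [CompleteSpace E] {F : E → ℝ} (hconv : ConvexOn ℝ univ F)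
    (hF : Differentiable ℝ F) (x h : E) {t : ℝ} (ht : 0 < t) :
    F x + t * ⟪gradient F x, h⟫ ≤ F (x + t • h) := by
  have hφ : ConvexOn ℝ univ (fun t : ℝ => F (x + t • h)) := by
    have := hconv.comp_affineMap (AffineMap.lineMap x (x + h))
    simpa [Function.comp_def, AffineMap.lineMap_apply, add_comm] using this
  have hslope := hφ.le_slope_of_hasDerivAt (mem_univ 0) (mem_univ t) ht
    (hasDerivAt_comp_add_smul hF x h 0)
  rw [slope_def_field, le_div_iff₀ (by simpa using ht)] at hslope
  simp only [zero_smul, add_zero, sub_zero] at hslope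
  linarith

theorem differentiableAt_gradient_of_contDiffAt {E : Type*} [NormedAddCommGroup E]
    [InnerProductSpace ℝ E] [CompleteSpace E] {F : E → ℝ} {x : E} (hF : ContDiffAt ℝ 2 F x) :
    DifferentiableAt ℝ (gradient F) x := by
  have hfd : DifferentiableAt ℝ (fderiv ℝ F) x :=
    (hF.fderiv_right (m := 1) (by norm_num)).differentiableAt (by norm_num)
  exact (InnerProductSpace.toDual ℝ E).symm.toContinuousLinearEquiv.differentiableAt.comp x hfd

/-- Under non-degeneracy and restricted positive-definiteness of the Hessian on
`T = (lin(∂J(x*)))ᗮ`, a minimizer `x*` of `Φ = F + J` is the unique minimizer. -/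
theorem uniqueness_of_minimizer {n : ℕ} (F J : EuclideanSpace ℝ (Fin n) → ℝ)
    (hJconv : ConvexOn ℝ Set.univ J) (hFconv : ConvexOn ℝ Set.univ F)
    (hF1 : ContDiff ℝ 1 F)
    (xstar : EuclideanSpace ℝ (Fin n))
    (hF2 : ContDiffAt ℝ 2 F xstar)
    (hmin : IsMinOn (fun x => F x + J x) Set.univ xstar)
    (hnd : -(gradient F xstar) ∈ intrinsicInterior ℝ (subdiff J xstar))
    (α : ℝ) (hα : 0 < α)
    (hsc : ∀ h ∈ ((affineSpan ℝ (subdiff J xstar)).direction)ᗮ,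
      α * ‖h‖ ^ 2 ≤ ⟪h, fderiv ℝ (gradient F) xstar h⟫) :
    ∀ z, IsMinOn (fun x => F x + J x) Set.univ z → z = xstar := by
  intro z hz
  have hFd : Differentiable ℝ F := hF1.differentiable (by norm_num)
  set h := z - xstar with hh
  have hΦz : F z + J z = F xstar + J xstar :=
    le_antisymm (hz (mem_univ xstar)) (hmin (mem_univ z))
  have hu : -(gradient F xstar) ∈ subdiff J xstar := intrinsicInterior_subset hnd
  have hle : ∀ u ∈ subdiff J xstar, ⟪u, h⟫ + ⟪gradient F xstar, h⟫ ≤ 0 := by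
    intro u hu
    have hJz : J z ≥ J xstar + ⟪u, h⟫ := hu z
    have hFz := hFconv.add_mul_inner_gradient_le hFd xstar h one_pos
    simp only [one_smul, one_mul, hh, add_sub_cancel] at hFz hJz ⊢
    linarith
  have hT : h ∈ ((affineSpan ℝ (subdiff J xstar)).direction)ᗮ := by
    have hnonpos : ∀ d ∈ (affineSpan ℝ (subdiff J xstar)).direction, ⟪d, h⟫ ≤ 0 := by
      intro d hd
      obtain ⟨ε, hε, hmem⟩ := exists_pos_add_smul_mem_of_mem_intrinsicInterior hnd hd
      have := hle _ hmem
      rw [inner_add_left, inner_neg_left, real_inner_smul_left] at this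
      exact nonpos_of_mul_nonpos_right (by linarith) hε
    rw [Submodule.mem_orthogonal]
    intro d hd
    have hneg := hnonpos (-d) (neg_mem hd)
    rw [inner_neg_left] at hneg
    exact le_antisymm (hnonpos d hd) (by linarith)
  have haff : ∀ t ∈ Ioo (0 : ℝ) 1,
      F (xstar + t • h) = F xstar + t * ⟪gradient F xstar, h⟫ := by
    intro t ht
    refine le_antisymm ?_ (hFconv.add_mul_inner_gradient_le hFd xstar h ht.1)
    have hJt := hu (xstar + t • h)
    rw [add_sub_cancel_left, inner_neg_left, real_inner_smul_right] at hJt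
    have hΦt := (hFconv.add hJconv).2 (mem_univ xstar) (mem_univ z)
      (sub_nonneg.2 ht.2.le) ht.1.le (sub_add_cancel 1 t)
    have hpt : (1 - t) • xstar + t • z = xstar + t • h := by rw [hh]; module
    simp only [hpt, Pi.add_apply, smul_eq_mul, hΦz] at hΦt
    linarith
  have hzero := inner_fderiv_gradient_eq_zero hFd
    (differentiableAt_gradient_of_contDiffAt hF2) haff
  have hnorm : ‖h‖ ^ 2 ≤ 0 := nonpos_of_mul_nonpos_right (hzero ▸ hsc h hT) hα
  exact sub_eq_zero.1 (norm_eq_zero.1 (pow_eq_zero_iff two_ne_zero |>.1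
    (le_antisymm hnorm (sq_nonneg _))))
end
end

section
/- Let F : E → ℝ be differentiable with β-Lipschitz gradient (β > 0), let J : E → ℝ be convex, let γ > 0 and α ∈ ℝ. Let x, y ∈ E satisfy ⟨x − y, ∇F(x) − ∇F(y)⟩ ≥ α‖x − y‖². Let p = prox_{γJ}(x − γ∇F(x)) and q = prox_{γJ}(y − γ∇F(y)). Then ‖p − q‖² ≤ (1 − 2αγ + β²γ²)·‖x − y‖². -/
open scoped RealInnerProductSpace
open Set

noncomputable section

/-- `p` is the proximal point of `w` for the function `γ • J`. -/
def IsProx {n : ℕ} (γ : ℝ) (J : EuclideanSpace ℝ (Fin n) → ℝ)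
    (w p : EuclideanSpace ℝ (Fin n)) : Prop :=
  ∀ z, (1/2) * ‖p - w‖ ^ 2 + γ * J p ≤ (1/2) * ‖z - w‖ ^ 2 + γ * J z

/-- Variational inequality characterizing the proximal point of a convex function. -/
theorem IsProx.inner_le {n : ℕ} {γ : ℝ} (hγ : 0 ≤ γ) {J : EuclideanSpace ℝ (Fin n) → ℝ}
    (hJ : ConvexOn ℝ Set.univ J) {w p : EuclideanSpace ℝ (Fin n)} (hp : IsProx γ J w p)
    (z : EuclideanSpace ℝ (Fin n)) :
    ⟪w - p, z - p⟫ ≤ γ * (J z - J p) := by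
  have key : ∀ t : ℝ, 0 < t → t ≤ 1 →
      0 ≤ γ * (J z - J p) - ⟪w - p, z - p⟫ + t / 2 * ‖z - p‖ ^ 2 := by
    intro t ht ht1
    have hmin := hp ((1 - t) • p + t • z)
    have hconv := hJ.2 (mem_univ p) (mem_univ z) (sub_nonneg.2 ht1) ht.le (by ring)
    have hexp : ‖(1 - t) • p + t • z - w‖ ^ 2
        = ‖p - w‖ ^ 2 - 2 * t * ⟪w - p, z - p⟫ + t ^ 2 * ‖z - p‖ ^ 2 := by
      have : (1 - t) • p + t • z - w = t • (z - p) - (w - p) := by module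
      rw [this, norm_sub_sq_real, norm_smul, real_inner_smul_left, real_inner_comm,
        norm_sub_rev p w, mul_pow, Real.norm_eq_abs, sq_abs]
      ring
    rw [hexp] at hmin
    simp only [smul_eq_mul] at hconv
    have hconv' := mul_le_mul_of_nonneg_left hconv hγ
    refine nonneg_of_mul_nonneg_right (a := t) ?_ ht
    nlinarith
  by_contra! hlt
  set b := ‖z - p‖ ^ 2 with hb
  have hb0 : 0 ≤ b := by positivity
  set c := ⟪w - p, z - p⟫ - γ * (J z - J p) with hc
  have hc0 : 0 < c := by linarith
  have hpos : 0 < c / (b + 1) := by positivity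
  have h := key (min 1 (c / (b + 1))) (lt_min one_pos hpos) (min_le_left _ _)
  have hle : min 1 (c / (b + 1)) * b ≤ c / (b + 1) * b :=
    mul_le_mul_of_nonneg_right (min_le_right _ _) hb0
  have hcb : c / (b + 1) * (b + 1) = c := div_mul_cancel₀ _ (by positivity)
  linarith

/-- The proximal map of a convex function is nonexpansive. -/
theorem IsProx.norm_sub_le {n : ℕ} {γ : ℝ} (hγ : 0 ≤ γ) {J : EuclideanSpace ℝ (Fin n) → ℝ}
    (hJ : ConvexOn ℝ Set.univ J) {v w p q : EuclideanSpace ℝ (Fin n)}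
    (hp : IsProx γ J v p) (hq : IsProx γ J w q) :
    ‖p - q‖ ≤ ‖v - w‖ := by
  have h₁ := hp.inner_le hγ hJ q
  have h₂ := hq.inner_le hγ hJ p
  have hfirm : ‖p - q‖ ^ 2 ≤ ⟪v - w, p - q⟫ := by
    have : ⟪v - p, q - p⟫ + ⟪w - q, p - q⟫ = ‖p - q‖ ^ 2 - ⟪v - w, p - q⟫ := by
      rw [← neg_sub p q, inner_neg_right, ← real_inner_self_eq_norm_sq, neg_add_eq_sub,
        ← inner_sub_left, ← inner_sub_left]
      congr 1
      abel
    linarith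
  have hcs := real_inner_le_norm (v - w) (p - q)
  by_contra! hlt
  nlinarith [norm_nonneg (v - w)]

/-- Contraction property of one Forward–Backward step under `α`-strong monotonicity
of the gradient at the pair `(x, y)` and `β`-Lipschitz continuity of the gradient. -/
theorem fb_step_contraction {n : ℕ}
    (F J : EuclideanSpace ℝ (Fin n) → ℝ)
    (hF : Differentiable ℝ F)
    (β : ℝ) (hβ : 0 < β)
    (hlip : ∀ a b, ‖gradient F a - gradient F b‖ ≤ β * ‖a - b‖)
    (hJ : ConvexOn ℝ Set.univ J)
    (γ : ℝ) (hγ : 0 < γ) (α : ℝ)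
    (x y p q : EuclideanSpace ℝ (Fin n))
    (hmono : α * ‖x - y‖ ^ 2 ≤ ⟪x - y, gradient F x - gradient F y⟫)
    (hp : IsProx γ J (x - γ • gradient F x) p)
    (hq : IsProx γ J (y - γ • gradient F y) q) :
    ‖p - q‖ ^ 2 ≤ (1 - 2 * α * γ + β ^ 2 * γ ^ 2) * ‖x - y‖ ^ 2 := by
  have hne := pow_le_pow_left₀ (norm_nonneg _) (hp.norm_sub_le hγ.le hJ hq) 2
  have hlip' := pow_le_pow_left₀ (norm_nonneg _) (hlip x y) 2
  have hexp : ‖(x - γ • gradient F x) - (y - γ • gradient F y)‖ ^ 2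
      = ‖x - y‖ ^ 2 - 2 * γ * ⟪x - y, gradient F x - gradient F y⟫
        + γ ^ 2 * ‖gradient F x - gradient F y‖ ^ 2 := by
    have : (x - γ • gradient F x) - (y - γ • gradient F y)
        = (x - y) - γ • (gradient F x - gradient F y) := by module
    rw [this, norm_sub_sq_real, norm_smul, real_inner_smul_right, mul_pow, Real.norm_eq_abs,
      sq_abs]
    ring
  have hm := mul_le_mul_of_nonneg_left hmono hγ.le
  have hl := mul_le_mul_of_nonneg_left hlip' (sq_nonneg γ)
  rw [hexp] at hne
  linarith
end
end

section
/- Let B : E → E be a self-adjoint continuous linear operator and σm, σM ∈ ℝ such that σm‖u‖² ≤ ⟨B u, u⟩ ≤ σM‖u‖² for all u ∈ E. Then for every γ ∈ ℝ and every u ∈ E, ‖u − γ B u‖ ≤ max(|1 − γσm|, |1 − γσM|)·‖u‖. -/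
open scoped RealInnerProductSpace
open Set

noncomputable section

theorem ContinuousLinearMap.norm_le_of_abs_inner_self_le {E : Type*} [NormedAddCommGroup E]
    [InnerProductSpace ℝ E] {T : E →L[ℝ] E} (hT : (T : E →ₗ[ℝ] E).IsSymmetric) {M : ℝ}
    (hM : 0 ≤ M) (h : ∀ x, |⟪T x, x⟫| ≤ M * ‖x‖ ^ 2) : ‖T‖ ≤ M := by
  rw [T.norm_eq_iSup_rayleighQuotient hT]
  refine ciSup_le fun x => ?_
  rw [abs_div, abs_sq]
  exact div_le_of_le_mul₀ (sq_nonneg _) hM (h x)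

theorem abs_one_sub_mul_le_max {a b r : ℝ} (har : a ≤ r) (hrb : r ≤ b) (γ : ℝ) :
    |1 - γ * r| ≤ max |1 - γ * a| |1 - γ * b| := by
  rcases le_total 0 γ with hγ | hγ
  · rw [max_comm]
    exact abs_le_max_abs_abs (by gcongr) (by gcongr)
  · exact abs_le_max_abs_abs (sub_le_sub_left (mul_le_mul_of_nonpos_left har hγ) 1)
      (sub_le_sub_left (mul_le_mul_of_nonpos_left hrb hγ) 1)

/-- For a self-adjoint operator `B` with spectrum bounds `σm ≤ B ≤ σM`,
the operator `Id - γ B` has norm at most `max |1 - γ σm| |1 - γ σM|`. -/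
theorem norm_id_sub_smul_le {n : ℕ}
    (B : EuclideanSpace ℝ (Fin n) →L[ℝ] EuclideanSpace ℝ (Fin n))
    (hsa : ∀ u v, ⟪B u, v⟫ = ⟪u, B v⟫)
    (σm σM : ℝ)
    (hlb : ∀ u, σm * ‖u‖ ^ 2 ≤ ⟪B u, u⟫)
    (hub : ∀ u, ⟪B u, u⟫ ≤ σM * ‖u‖ ^ 2)
    (γ : ℝ) (u : EuclideanSpace ℝ (Fin n)) :
    ‖u - γ • B u‖ ≤ max |1 - γ * σm| |1 - γ * σM| * ‖u‖ := by
  have hsymm : ((ContinuousLinearMap.id ℝ _ - γ • B : EuclideanSpace ℝ (Fin n) →L[ℝ] _) :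
      EuclideanSpace ℝ (Fin n) →ₗ[ℝ] _).IsSymmetric := fun x y => by
    simp [inner_sub_left, inner_sub_right, inner_smul_left, inner_smul_right, hsa]
  refine ContinuousLinearMap.le_of_opNorm_le _
    (ContinuousLinearMap.norm_le_of_abs_inner_self_le hsymm (by positivity) fun x => ?_) u
  rcases eq_or_ne x 0 with rfl | hx
  · simp
  have hpos : 0 < ‖x‖ ^ 2 := by positivity
  have hinner : ⟪(ContinuousLinearMap.id ℝ (EuclideanSpace ℝ (Fin n)) - γ • B) x, x⟫ =
      (1 - γ * (⟪B x, x⟫ / ‖x‖ ^ 2)) * ‖x‖ ^ 2 := by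
    simp only [sub_apply, ContinuousLinearMap.id_apply,
      smul_apply, inner_sub_left, real_inner_smul_left,
      real_inner_self_eq_norm_sq]
    field_simp
  rw [hinner, abs_mul, abs_sq]
  gcongr
  exact abs_one_sub_mul_le_max ((le_div_iff₀ hpos).2 (hlb x)) ((div_le_iff₀ hpos).2 (hub x)) γ
end
end

section
/- Let 0 < σm ≤ σM be real numbers. Then for every γ ∈ ℝ, max(|1 − γσm|, |1 − γσM|) ≥ (σM − σm)/(σM + σm), and equality holds if and only if γ = 2/(σm + σM). -/
/-- Optimal step-size for the linear rate: `max(|1 - γ σm|, |1 - γ σM|)` is minimized,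
with value `(σM - σm)/(σM + σm)`, exactly at `γ = 2/(σm + σM)`. -/
theorem optimal_linear_rate (σm σM : ℝ) (h0 : 0 < σm) (hm : σm ≤ σM) (γ : ℝ) :
    (σM - σm) / (σM + σm) ≤ max |1 - γ * σm| |1 - γ * σM| ∧
      (max |1 - γ * σm| |1 - γ * σM| = (σM - σm) / (σM + σm) ↔ γ = 2 / (σm + σM)) := by
  have hM : 0 < σM := h0.trans_le hm
  have hs : 0 < σM + σm := add_pos hM h0
  have hlow : 1 - γ * σm ≤ max |1 - γ * σm| |1 - γ * σM| :=
    (le_abs_self _).trans (le_max_left _ _)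
  have hupp : -(1 - γ * σM) ≤ max |1 - γ * σm| |1 - γ * σM| :=
    (neg_le_abs _).trans (le_max_right _ _)
  refine ⟨?_, fun h => ?_, fun h => ?_⟩
  · rw [div_le_iff₀ hs]
    linarith [mul_le_mul_of_nonneg_left hlow hM.le, mul_le_mul_of_nonneg_left hupp h0.le]
  · rw [h, le_div_iff₀ hs] at hlow hupp
    rw [eq_div_iff (by positivity)]
    apply le_antisymm
    · refine le_of_mul_le_mul_left ?_ hM
      linarith
    · refine le_of_mul_le_mul_left ?_ h0
      linarith
  · have hm_eq : 1 - γ * σm = (σM - σm) / (σM + σm) := by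
      rw [h]; field_simp; ring
    have hM_eq : 1 - γ * σM = -((σM - σm) / (σM + σm)) := by
      rw [h]; field_simp; ring
    rw [hm_eq, hM_eq, abs_neg, max_self, abs_of_nonneg (div_nonneg (sub_nonneg.2 hm) hs.le)]
end

section
/- Let A : ℝⁿ → ℝᵐ be linear, y ∈ ℝᵐ, and set F(x) = (1/2)‖Ax − y‖². Let J : ℝⁿ → ℝ be convex and let x* be a minimizer of Φ = F + J. Let T ⊆ ℝⁿ be a linear subspace and σm, σM ∈ ℝ with σm > 0 such that σm‖u‖² ≤ ‖A u‖² ≤ σM‖u‖² for all u ∈ T. Let (γ_k) be positive step sizes and let (x_k) satisfy x_{k+1} = prox_{γ_k J}(x_k − γ_k A*(A x_k − y)) for all k. Suppose there is K ≥ 0 such that x_k − x* ∈ T for all k ≥ K. Then for every k ≥ K, ‖x_{k+1} − x*‖ ≤ max(|1 − γ_k σm|, |1 − γ_k σM|)·‖x_k − x*‖. -/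
open scoped RealInnerProductSpace
open Set

noncomputable section

/-- First-order optimality: a minimizer `p` of `z ↦ (1/2)‖L z - b‖² + c J z` with `J` convex
satisfies the associated variational inequality. -/
theorem ConvexOn.variational_inequality_of_isMinOn
    {E F : Type*} [NormedAddCommGroup E] [InnerProductSpace ℝ E]
    [NormedAddCommGroup F] [InnerProductSpace ℝ F]
    {J : E → ℝ} (hJ : ConvexOn ℝ Set.univ J) (L : E →L[ℝ] F) (b : F) {c : ℝ} (hc : 0 ≤ c) {p : E}
    (hp : ∀ z, (1/2) * ‖L p - b‖ ^ 2 + c * J p ≤ (1/2) * ‖L z - b‖ ^ 2 + c * J z) (z : E) :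
    0 ≤ ⟪L p - b, L (z - p)⟫ + c * (J z - J p) := by
  set a := ⟪L p - b, L (z - p)⟫ + c * (J z - J p) with ha
  set q := (1/2) * ‖L (z - p)‖ ^ 2 with hq
  have hq0 : 0 ≤ q := by positivity
  have key : ∀ t : ℝ, 0 < t → t ≤ 1 → 0 ≤ a + t * q := by
    intro t ht ht1
    have hconv := hJ.2 (Set.mem_univ p) (Set.mem_univ z) (sub_nonneg.2 ht1) ht.le (by ring)
    have hz : (1 - t) • p + t • z = p + t • (z - p) := by module
    rw [hz, smul_eq_mul, smul_eq_mul] at hconv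
    have hL : L (p + t • (z - p)) - b = (L p - b) + t • L (z - p) := by
      rw [map_add, map_smul]; abel
    have hmin := hp (p + t • (z - p))
    rw [hL, norm_add_sq_real, inner_smul_right, norm_smul, mul_pow, Real.norm_eq_abs,
      sq_abs] at hmin
    have hcJ := mul_le_mul_of_nonneg_left hconv hc
    have hmul : 0 ≤ t * (a + t * q) := by
      rw [ha, hq]; linarith
    exact nonneg_of_mul_nonneg_right hmul ht
  by_contra! hneg
  have hden : 0 < 2 * (q - a) := by linarith
  have ht := key (-a / (2 * (q - a))) (div_pos (by linarith) hden)
    ((div_le_one hden).2 (by linarith))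
  have hne : q - a ≠ 0 := (by linarith : 0 < q - a).ne'
  have heq : a + -a / (2 * (q - a)) * q = a * (q - 2 * a) / (2 * (q - a)) := by
    field_simp; ring
  rw [heq] at ht
  exact absurd ht (not_le.2 (div_neg_of_neg_of_pos
    (mul_neg_of_neg_of_pos hneg (by linarith)) hden))

/-- If the quadratic form `u ↦ ‖u‖² - g ‖L u‖²` is bounded by `ρ ‖u‖²` on `T`, its polar form
controls norms of elements of `T` with the same constant. -/
theorem norm_le_of_sq_le_polar
    {E F : Type*} [NormedAddCommGroup E] [InnerProductSpace ℝ E]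
    [NormedAddCommGroup F] [InnerProductSpace ℝ F] (L : E →L[ℝ] F) (T : Submodule ℝ E)
    {g ρ : ℝ} (hρ : 0 ≤ ρ) (hB : ∀ u ∈ T, |‖u‖ ^ 2 - g * ‖L u‖ ^ 2| ≤ ρ * ‖u‖ ^ 2)
    {d e : E} (hd : d ∈ T) (he : e ∈ T) (h : ‖e‖ ^ 2 ≤ ⟪d, e⟫ - g * ⟪L d, L e⟫) :
    ‖e‖ ≤ ρ * ‖d‖ := by
  have key : ∀ t : ℝ, 0 ≤ t → 2 * (t * ‖e‖ ^ 2) ≤ ρ * (‖d‖ ^ 2 + t ^ 2 * ‖e‖ ^ 2) := by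
    intro t ht
    have hadd := (abs_le.1 (hB _ (T.add_mem hd (T.smul_mem t he)))).2
    have hsub := (abs_le.1 (hB _ (T.sub_mem hd (T.smul_mem t he)))).1
    simp only [map_add, map_sub, map_smul, norm_add_sq_real, norm_sub_sq_real, inner_smul_right,
      norm_smul, mul_pow, Real.norm_eq_abs, sq_abs] at hadd hsub
    have := mul_le_mul_of_nonneg_left h ht
    linarith
  refine le_of_sq_le_sq ?_ (by positivity)
  rcases hρ.eq_or_lt with rfl | hρ
  · have := key 1 zero_le_one
    nlinarith
  · have := mul_le_mul_of_nonneg_left (key ρ⁻¹ (by positivity)) hρ.le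
    have h1 : ρ * (2 * (ρ⁻¹ * ‖e‖ ^ 2)) = 2 * ‖e‖ ^ 2 := by field_simp
    have h2 : ρ * (ρ * (‖d‖ ^ 2 + ρ⁻¹ ^ 2 * ‖e‖ ^ 2)) = (ρ * ‖d‖) ^ 2 + ‖e‖ ^ 2 := by field_simp
    linarith

/-- Local linear convergence of Forward–Backward for a quadratic data-fidelity term
`F(x) = (1/2)‖Ax - y‖²`, once the iterates satisfy `x_k - x* ∈ T`. -/
theorem fb_linear_rate_quadratic {n m : ℕ}
    (A : EuclideanSpace ℝ (Fin n) →L[ℝ] EuclideanSpace ℝ (Fin m))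
    (y : EuclideanSpace ℝ (Fin m))
    (J : EuclideanSpace ℝ (Fin n) → ℝ) (hJ : ConvexOn ℝ Set.univ J)
    (xstar : EuclideanSpace ℝ (Fin n))
    (hmin : IsMinOn (fun x => (1/2) * ‖A x - y‖ ^ 2 + J x) Set.univ xstar)
    (T : Submodule ℝ (EuclideanSpace ℝ (Fin n)))
    (σm σM : ℝ) (hσm : 0 < σm)
    (hlb : ∀ u ∈ T, σm * ‖u‖ ^ 2 ≤ ‖A u‖ ^ 2)
    (hub : ∀ u ∈ T, ‖A u‖ ^ 2 ≤ σM * ‖u‖ ^ 2)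
    (γ : ℕ → ℝ) (hγ : ∀ k, 0 < γ k)
    (x : ℕ → EuclideanSpace ℝ (Fin n))
    (hrec : ∀ k, IsProx (γ k) J
      (x k - γ k • (ContinuousLinearMap.adjoint A) (A (x k) - y)) (x (k+1)))
    (K : ℕ) (hK : ∀ k ≥ K, x k - xstar ∈ T) :
    ∀ k ≥ K, ‖x (k+1) - xstar‖ ≤
      max |1 - γ k * σm| |1 - γ k * σM| * ‖x k - xstar‖ := by
  intro k hk
  have hd := hK k hk
  have he := hK (k + 1) (by omega)
  have hg := hγ k
  refine norm_le_of_sq_le_polar A T (g := γ k) (le_max_of_le_left (abs_nonneg _)) ?_ hd he ?_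
  · intro u hu
    have hl := mul_le_mul_of_nonneg_left (hlb u hu) hg.le
    have hr := mul_le_mul_of_nonneg_left (hub u hu) hg.le
    have hmax1 := mul_le_mul_of_nonneg_right
      ((le_abs_self _).trans (le_max_left |1 - γ k * σm| |1 - γ k * σM|)) (sq_nonneg ‖u‖)
    have hmax2 := mul_le_mul_of_nonneg_right
      ((neg_le_abs _).trans (le_max_right |1 - γ k * σm| |1 - γ k * σM|)) (sq_nonneg ‖u‖)
    exact abs_le.2 ⟨by linarith, by linarith⟩
  · have hstar := hJ.variational_inequality_of_isMinOn A y zero_le_one (p := xstar)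
      (fun z => by simpa using hmin (Set.mem_univ z)) (x (k + 1))
    have hprox := hJ.variational_inequality_of_isMinOn (ContinuousLinearMap.id ℝ _) _ hg.le
      (hrec k) xstar
    have hstar' := mul_nonneg hg.le hstar
    set d := x k - xstar with hd_def
    set e := x (k + 1) - xstar with he_def
    have hAd : A (x k) - y = A d + (A xstar - y) := by rw [hd_def, map_sub]; abel
    have hstep : x (k + 1) - (x k - γ k • ContinuousLinearMap.adjoint A (A (x k) - y))
        = e - d + γ k • ContinuousLinearMap.adjoint A (A (x k) - y) := by
      rw [hd_def, he_def]; abel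
    have hneg : xstar - x (k + 1) = -e := by rw [he_def]; abel
    simp only [ContinuousLinearMap.id_apply] at hprox
    rw [hstep, hneg, inner_neg_right, inner_add_left, inner_sub_left, real_inner_smul_left,
      ContinuousLinearMap.adjoint_inner_left, hAd, inner_add_left,
      real_inner_self_eq_norm_sq] at hprox
    linarith
end
end

section
/- Let F : E → ℝ be convex and differentiable with β-Lipschitz gradient (β > 0), let J : E → ℝ be convex, and let 0 < γ ≤ 2/β. Let x ∈ E and x⁺ = prox_{γJ}(x − γ∇F(x)). Then there exists u ∈ ∂J(x⁺) such that ‖∇F(x⁺) + u‖ ≤ (1/γ)‖x − x⁺‖. -/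
open scoped RealInnerProductSpace
open Set

noncomputable section

section GradientInequalities

variable {E : Type*} [NormedAddCommGroup E] [InnerProductSpace ℝ E] [CompleteSpace E]

/-- Restriction of a differentiable function to a line, differentiated through the gradient. -/
lemma hasDerivAt_comp_lineMap_gradient {F : E → ℝ} (hF : Differentiable ℝ F)
    (a b : E) (t : ℝ) :
    HasDerivAt (fun s : ℝ => F (AffineMap.lineMap a b s))
      ⟪gradient F (AffineMap.lineMap a b t), b - a⟫ t := by
  exact (hF (AffineMap.lineMap a b t)).hasGradientAt.hasFDerivAt.comp_hasDerivAt t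
    AffineMap.hasDerivAt_lineMap

/-- First-order characterization of convexity: the graph lies above its tangents. -/
lemma ConvexOn.add_inner_gradient_le {F : E → ℝ} (hFc : ConvexOn ℝ univ F)
    (hF : Differentiable ℝ F) (a b : E) :
    F a + ⟪gradient F a, b - a⟫ ≤ F b := by
  have hc : ConvexOn ℝ univ (fun s : ℝ => F (AffineMap.lineMap a b s)) :=
    hFc.comp_affineMap (AffineMap.lineMap a b)
  have h := hc.le_slope_of_hasDerivAt (mem_univ 0) (mem_univ 1) one_pos
    (hasDerivAt_comp_lineMap_gradient hF a b 0)
  simp only [slope_def_field, AffineMap.lineMap_apply_zero, AffineMap.lineMap_apply_one] at h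
  linarith

/-- Descent lemma: a function with `β`-Lipschitz gradient lies below its quadratic upper model. -/
lemma le_add_inner_gradient_add_sq {F : E → ℝ} (hF : Differentiable ℝ F) {β : ℝ}
    (hlip : ∀ a b, ‖gradient F a - gradient F b‖ ≤ β * ‖a - b‖) (a b : E) :
    F b ≤ F a + ⟪gradient F a, b - a⟫ + β / 2 * ‖b - a‖ ^ 2 := by
  have hd (t : ℝ) := ((hasDerivAt_comp_lineMap_gradient hF a b t).sub
    ((hasDerivAt_id t).mul_const ⟪gradient F a, b - a⟫)).sub
    (((hasDerivAt_id t).pow 2).mul_const (β / 2 * ‖b - a‖ ^ 2))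
  have hanti := antitoneOn_of_deriv_nonpos (convex_Icc (0 : ℝ) 1)
    (fun t _ => (hd t).continuousAt.continuousWithinAt)
    (fun t _ => (hd t).differentiableAt.differentiableWithinAt)
    (fun t ht => by
      rw [interior_Icc] at ht
      rw [(hd t).deriv]
      have hinner := real_inner_le_norm
        (gradient F (AffineMap.lineMap a b t) - gradient F a) (b - a)
      have hl := hlip (AffineMap.lineMap a b t) a
      have hn : ‖AffineMap.lineMap a b t - a‖ = t * ‖b - a‖ := by
        rw [AffineMap.lineMap_apply, vsub_eq_sub, vadd_eq_add, add_sub_cancel_right, norm_smul,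
          Real.norm_of_nonneg ht.1.le]
      rw [hn] at hl
      rw [inner_sub_left] at hinner
      have := mul_le_mul_of_nonneg_right hl (norm_nonneg (b - a))
      simp only [id, Nat.cast_ofNat, Nat.add_one_sub_one, pow_one]
      linarith)
  have h := hanti (left_mem_Icc.2 zero_le_one) (right_mem_Icc.2 zero_le_one) zero_le_one
  simp only [Pi.sub_apply, Pi.pow_apply, id, AffineMap.lineMap_apply_zero,
    AffineMap.lineMap_apply_one] at h
  linarith

/-- Tangent inequality for a convex function with `β`-Lipschitz gradient, with the quadratic
gain in the difference of the gradients. -/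
lemma ConvexOn.add_inner_gradient_add_sq_le {F : E → ℝ}
    (hFc : ConvexOn ℝ univ F) (hF : Differentiable ℝ F) {β : ℝ} (hβ : 0 < β)
    (hlip : ∀ a b, ‖gradient F a - gradient F b‖ ≤ β * ‖a - b‖) (a b : E) :
    F a + ⟪gradient F a, b - a⟫ + 1 / (2 * β) * ‖gradient F b - gradient F a‖ ^ 2 ≤ F b := by
  set δ := gradient F b - gradient F a with hδ
  have hlow := hFc.add_inner_gradient_le hF a (b - β⁻¹ • δ)
  have hup := le_add_inner_gradient_add_sq hF hlip b (b - β⁻¹ • δ)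
  rw [sub_sub_cancel_left, norm_neg, norm_smul, inner_neg_right, inner_smul_right,
    Real.norm_of_nonneg (inv_pos.2 hβ).le] at hup
  rw [sub_right_comm, inner_sub_right, inner_smul_right] at hlow
  have hsq : ⟪gradient F b, δ⟫ - ⟪gradient F a, δ⟫ = ‖δ‖ ^ 2 := by
    rw [← inner_sub_left, ← hδ, real_inner_self_eq_norm_sq]
  have hmul : β⁻¹ * ⟪gradient F b, δ⟫ - β⁻¹ * ⟪gradient F a, δ⟫ = β⁻¹ * ‖δ‖ ^ 2 := by
    rw [← mul_sub, hsq]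
  have hquad : β / 2 * (β⁻¹ * ‖δ‖) ^ 2 = β⁻¹ * ‖δ‖ ^ 2 / 2 := by field_simp
  have hgain : 1 / (2 * β) * ‖δ‖ ^ 2 = β⁻¹ * ‖δ‖ ^ 2 / 2 := by field_simp
  linarith

/-- Baillon–Haddad: the `β`-Lipschitz gradient of a convex function is `1/β`-cocoercive. -/
lemma ConvexOn.gradient_cocoercive {F : E → ℝ}
    (hFc : ConvexOn ℝ univ F) (hF : Differentiable ℝ F) {β : ℝ} (hβ : 0 < β)
    (hlip : ∀ a b, ‖gradient F a - gradient F b‖ ≤ β * ‖a - b‖) (a b : E) :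
    ‖gradient F a - gradient F b‖ ^ 2 ≤ β * ⟪gradient F a - gradient F b, a - b⟫ := by
  have hab := hFc.add_inner_gradient_add_sq_le hF hβ hlip a b
  have hba := hFc.add_inner_gradient_add_sq_le hF hβ hlip b a
  rw [norm_sub_rev, ← neg_sub a b, inner_neg_right] at hab
  have hsum : 1 / β * ‖gradient F a - gradient F b‖ ^ 2 ≤
      ⟪gradient F a - gradient F b, a - b⟫ := by
    rw [inner_sub_left]
    have : 1 / β * ‖gradient F a - gradient F b‖ ^ 2 =
        2 * (1 / (2 * β) * ‖gradient F a - gradient F b‖ ^ 2) := by field_simp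
    linarith
  rwa [one_div, inv_mul_le_iff₀ hβ] at hsum

/-- For `γ ≤ 2 / β`, the gradient step `id - γ ∇F` is nonexpansive. -/
lemma ConvexOn.norm_sub_smul_gradient_sub_le {F : E → ℝ}
    (hFc : ConvexOn ℝ univ F) (hF : Differentiable ℝ F) {β : ℝ} (hβ : 0 < β)
    (hlip : ∀ a b, ‖gradient F a - gradient F b‖ ≤ β * ‖a - b‖)
    {γ : ℝ} (hγ : 0 ≤ γ) (hγβ : γ ≤ 2 / β) (a b : E) :
    ‖(a - b) - γ • (gradient F a - gradient F b)‖ ≤ ‖a - b‖ := by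
  have hco := hFc.gradient_cocoercive hF hβ hlip a b
  set g := gradient F a - gradient F b
  have hstep : γ * ‖g‖ ^ 2 ≤ 2 * ⟪g, a - b⟫ := by
    rw [le_div_iff₀ hβ] at hγβ
    have := mul_le_mul_of_nonneg_left hco hγ
    have hmono : 0 ≤ ⟪g, a - b⟫ :=
      nonneg_of_mul_nonneg_right ((sq_nonneg ‖g‖).trans hco) hβ
    have := mul_le_mul_of_nonneg_right hγβ hmono
    linarith
  refine le_of_sq_le_sq ?_ (norm_nonneg _)
  rw [norm_sub_sq_real, norm_smul, Real.norm_of_nonneg hγ, inner_smul_right, real_inner_comm]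
  have := mul_le_mul_of_nonneg_left hstep hγ
  nlinarith

end GradientInequalities

/-- Optimality condition of the proximal point. -/
lemma IsProx.smul_sub_mem_subdiff {n : ℕ} {γ : ℝ} {J : EuclideanSpace ℝ (Fin n) → ℝ}
    {w p : EuclideanSpace ℝ (Fin n)} (hp : IsProx γ J w p) (hJ : ConvexOn ℝ univ J) (hγ : 0 < γ) :
    γ⁻¹ • (w - p) ∈ subdiff J p := by
  intro z
  have hsegment (t : ℝ) (ht : t ∈ Ioc (0 : ℝ) 1) :
      0 ≤ ⟪p - w, z - p⟫ + γ * (J z - J p) + t * (‖z - p‖ ^ 2 / 2) := by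
    have hmin := hp ((1 - t) • p + t • z)
    have hconv := hJ.2 (mem_univ p) (mem_univ z) (sub_nonneg.2 ht.2) ht.1.le (sub_add_cancel 1 t)
    have hpoint : (1 - t) • p + t • z - w = (p - w) + t • (z - p) := by module
    rw [hpoint, norm_add_sq_real, inner_smul_right, norm_smul, Real.norm_of_nonneg ht.1.le] at hmin
    have := mul_le_mul_of_nonneg_left hconv hγ.le
    simp only [smul_eq_mul] at this
    refine nonneg_of_mul_nonneg_right (a := t) ?_ ht.1
    nlinarith
  have hlim : Filter.Tendsto
      (fun t : ℝ => ⟪p - w, z - p⟫ + γ * (J z - J p) + t * (‖z - p‖ ^ 2 / 2))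
      (nhdsWithin 0 (Ioi 0)) (nhds (⟪p - w, z - p⟫ + γ * (J z - J p))) := by
    refine Filter.Tendsto.mono_left ?_ nhdsWithin_le_nhds
    exact Continuous.tendsto' (by fun_prop) _ _ (by simp)
  have hlimit := ge_of_tendsto hlim
    (Filter.eventually_of_mem (Ioc_mem_nhdsGT one_pos) hsegment)
  have hscaled : γ⁻¹ * ⟪w - p, z - p⟫ ≤ J z - J p := by
    rw [inv_mul_le_iff₀ hγ, ← neg_sub p w, inner_neg_left]
    linarith
  rw [real_inner_smul_left]
  linarith

/-- The Forward–Backward step produces a point at which the subgradient residual of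
`Φ = F + J` is controlled by the step length. -/
theorem fb_subgradient_residual {n : ℕ}
    (F J : EuclideanSpace ℝ (Fin n) → ℝ)
    (hFc : ConvexOn ℝ Set.univ F) (hF : Differentiable ℝ F)
    (β : ℝ) (hβ : 0 < β)
    (hlip : ∀ a b, ‖gradient F a - gradient F b‖ ≤ β * ‖a - b‖)
    (hJ : ConvexOn ℝ Set.univ J)
    (γ : ℝ) (hγ : 0 < γ) (hγ2 : γ ≤ 2 / β)
    (x xp : EuclideanSpace ℝ (Fin n))
    (hxp : IsProx γ J (x - γ • gradient F x) xp) :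
    ∃ u ∈ subdiff J xp, ‖gradient F xp + u‖ ≤ (1/γ) * ‖x - xp‖ := by
  refine ⟨γ⁻¹ • (x - γ • gradient F x - xp), hxp.smul_sub_mem_subdiff hJ hγ, ?_⟩
  have hres : gradient F xp + γ⁻¹ • (x - γ • gradient F x - xp) =
      γ⁻¹ • ((x - xp) - γ • (gradient F x - gradient F xp)) := by
    simp only [smul_sub, inv_smul_smul₀ hγ.ne']
    abel
  rw [hres, norm_smul, Real.norm_of_nonneg (inv_pos.2 hγ).le, one_div]
  exact mul_le_mul_of_nonneg_left
    (hFc.norm_sub_smul_gradient_sub_le hF hβ hlip hγ.le hγ2 x xp) (inv_pos.2 hγ).le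
end
end

section
/- (Finite support identification for the Lasso) Let A : ℝⁿ → ℝᵐ be linear, y ∈ ℝᵐ, λ > 0, and Φ(x) = (1/2)‖Ax − y‖² + λ‖x‖₁. Let β = ‖A*A‖ (the operator norm), let 0 < a ≤ b < 2/β, and let (x_k) satisfy x_{k+1} = prox_{γ_k λ‖·‖₁}(x_k − γ_k A*(A x_k − y)) with γ_k ∈ [a, b] for all k. Suppose x_k converges to a minimizer x* of Φ satisfying the nondegeneracy condition: for every index i with x*ᵢ = 0, |(A*(A x* − y))ᵢ| < λ. Then there exists K ≥ 0 such that for every k ≥ K and every index i, x*ᵢ = 0 implies (x_k)ᵢ = 0. -/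
open scoped RealInnerProductSpace
open Set Filter

noncomputable section

/-- Setting to zero a coordinate of a proximal point of `γ lam ‖·‖₁` whose input is at most
the threshold `γ lam` in absolute value cannot increase the objective, so it is already zero. -/
theorem IsProx.apply_eq_zero_of_abs_le {n : ℕ} {γ lam : ℝ} {w p : EuclideanSpace ℝ (Fin n)}
    (h : IsProx γ (fun z => lam * ∑ i, |z i|) w p) {i : Fin n} (hw : |w i| ≤ γ * lam) :
    p i = 0 := by
  have hz := h (p - EuclideanSpace.single i (p i))
  have hnorm : ‖p - EuclideanSpace.single i (p i) - w‖ ^ 2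
      = ‖p - w‖ ^ 2 - 2 * (p i * (p i - w i)) + p i ^ 2 := by
    rw [sub_right_comm, norm_sub_sq_real, EuclideanSpace.inner_single_right]
    simp
  have hsum : ∑ j, |(p - EuclideanSpace.single i (p i)) j| = ∑ j, |p j| - |p i| := by
    have hcoord : ∀ j, |(p - EuclideanSpace.single i (p i)) j|
        = |p j| - if j = i then |p i| else 0 := by
      intro j
      by_cases hj : j = i
      · subst hj; simp
      · simp [hj]
    simp only [hcoord, Finset.sum_sub_distrib, Finset.sum_ite_eq', Finset.mem_univ, if_true]
  simp only [hnorm, hsum] at hz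
  have hpw : p i * w i ≤ |p i| * (γ * lam) :=
    (le_abs_self _).trans <| by rw [abs_mul]; gcongr
  have hsq : p i ^ 2 ≤ 0 := by linarith
  exact pow_eq_zero_iff two_ne_zero |>.mp (le_antisymm hsq (sq_nonneg _))

/-- Finite support identification for the Lasso: under the non-degeneracy condition,
the Forward–Backward iterates eventually vanish on the complement of the support
of the limit minimizer `x*`. -/
theorem lasso_finite_identification {n m : ℕ}
    (A : EuclideanSpace ℝ (Fin n) →L[ℝ] EuclideanSpace ℝ (Fin m))
    (y : EuclideanSpace ℝ (Fin m)) (lam : ℝ) (hlam : 0 < lam)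
    (a b : ℝ) (ha : 0 < a) (hab : a ≤ b)
    (hb : b < 2 / ‖(ContinuousLinearMap.adjoint A).comp A‖)
    (γ : ℕ → ℝ) (hγ : ∀ k, γ k ∈ Set.Icc a b)
    (x : ℕ → EuclideanSpace ℝ (Fin n))
    (hrec : ∀ k, IsProx (γ k) (fun z => lam * ∑ i, |z i|)
      (x k - γ k • (ContinuousLinearMap.adjoint A) (A (x k) - y)) (x (k+1)))
    (xstar : EuclideanSpace ℝ (Fin n))
    (hmin : IsMinOn (fun z => (1/2) * ‖A z - y‖ ^ 2 + lam * ∑ i, |z i|) Set.univ xstar)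
    (hlim : Filter.Tendsto x Filter.atTop (nhds xstar))
    (hnd : ∀ i, xstar i = 0 → |(ContinuousLinearMap.adjoint A (A xstar - y)) i| < lam) :
    ∃ K : ℕ, ∀ k ≥ K, ∀ i, xstar i = 0 → x k i = 0 := by
  have hx : ∀ i, Tendsto (fun k => x k i) atTop (nhds (xstar i)) := fun i =>
    ((by fun_prop : Continuous fun z : EuclideanSpace ℝ (Fin n) => z i).tendsto xstar).comp hlim
  have hgrad : ∀ i, Tendsto (fun k => (ContinuousLinearMap.adjoint A (A (x k) - y)) i) atTop
      (nhds ((ContinuousLinearMap.adjoint A (A xstar - y)) i)) := fun i =>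
    ((by fun_prop : Continuous fun z => (ContinuousLinearMap.adjoint A (A z - y)) i).tendsto
      xstar).comp hlim
  have hev : ∀ᶠ k in atTop, ∀ i, xstar i = 0 → x (k + 1) i = 0 := by
    refine eventually_all.2 fun i => ?_
    by_cases hi : xstar i = 0
    swap
    · exact Eventually.of_forall fun k h => absurd h hi
    have hlt : |xstar i| < a * (lam - |(ContinuousLinearMap.adjoint A (A xstar - y)) i|) := by
      rw [hi, abs_zero]
      exact mul_pos ha (sub_pos.2 (hnd i hi))
    filter_upwards [(hx i).abs.eventually_lt (((hgrad i).abs.const_sub lam).const_mul a) hlt]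
      with k hk _
    refine (hrec k).apply_eq_zero_of_abs_le ?_
    have hγa : a ≤ γ k := (hγ k).1
    have hgap : 0 ≤ lam - |(ContinuousLinearMap.adjoint A (A (x k) - y)) i| :=
      (pos_of_mul_pos_right ((abs_nonneg _).trans_lt hk) ha.le).le
    calc |(x k - γ k • ContinuousLinearMap.adjoint A (A (x k) - y)) i|
        ≤ |x k i| + |γ k * (ContinuousLinearMap.adjoint A (A (x k) - y)) i| :=
        norm_sub_le (x k i) (γ k * (ContinuousLinearMap.adjoint A (A (x k) - y)) i)
      _ = |x k i| + γ k * |(ContinuousLinearMap.adjoint A (A (x k) - y)) i| := by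
        rw [abs_mul, abs_of_pos (ha.trans_le hγa)]
      _ ≤ γ k * lam := by linarith [mul_le_mul_of_nonneg_right hγa hgap]
  obtain ⟨K, hK⟩ := eventually_atTop.1 hev
  refine ⟨K + 1, fun k hk => ?_⟩
  obtain ⟨j, rfl⟩ := Nat.exists_eq_add_of_le' (Nat.one_le_of_lt hk)
  exact hK j (Nat.le_of_succ_le_succ hk)
end
end

section
/- (Local linear convergence for the Lasso) Let A : ℝⁿ → ℝᵐ be linear, y ∈ ℝᵐ, λ > 0, and Φ(x) = (1/2)‖Ax − y‖² + λ‖x‖₁. Let β = ‖A*A‖ (the operator norm), 0 < a ≤ b < 2/β, and let (x_k) satisfy x_{k+1} = prox_{γ_k λ‖·‖₁}(x_k − γ_k A*(A x_k − y)) with γ_k ∈ [a, b]. Suppose x_k converges to a minimizer x* of Φ such that: (i) for every index i with x*ᵢ = 0, |(A*(A x* − y))ᵢ| < λ; and (ii) ker A ∩ T = {0}, where T = {u ∈ ℝⁿ : uᵢ = 0 whenever x*ᵢ = 0}. Let σm, σM ∈ ℝ with σm > 0 satisfy σm‖u‖² ≤ ‖Au‖² ≤ σM‖u‖² for all u ∈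 T. Then there exists K ≥ 0 such that for all k ≥ K, ‖x_{k+1} − x*‖ ≤ max(|1 − γ_k σm|, |1 − γ_k σM|)·‖x_k − x*‖. -/
open scoped RealInnerProductSpace
open Set Filter

noncomputable section

/-- Variation of the proximal objective of the `ℓ¹`-norm along a coordinate direction. -/
lemma IsProx.coordinate_variation {n : ℕ} {γ lam : ℝ} {w p : EuclideanSpace ℝ (Fin n)}
    (h : IsProx γ (fun z => lam * ∑ i, |z i|) w p) (i : Fin n) (t : ℝ) :
    0 ≤ t * (p i - w i) + t ^ 2 / 2 + γ * lam * (|p i + t| - |p i|) := by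
  have hz := h (p + EuclideanSpace.single i t)
  have hnorm : ‖p + EuclideanSpace.single i t - w‖ ^ 2
      = ‖p - w‖ ^ 2 + 2 * (t * (p i - w i)) + t ^ 2 := by
    rw [add_sub_right_comm, norm_add_sq_real, EuclideanSpace.inner_single_right]
    simp
  have hsum : ∑ j, |(p + EuclideanSpace.single i t) j| - ∑ j, |p j| = |p i + t| - |p i| := by
    rw [← Finset.sum_sub_distrib, Finset.sum_eq_single i]
    · simp
    · intro j _ hj
      simp [hj]
    · simp
  have hsum' := eq_add_of_sub_eq hsum
  simp only [hnorm, hsum'] at hz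
  linarith

/-- A scalar minimizing `z ↦ (z - w)² / 2 + c |z|` vanishes when `|w| < c`. -/
lemma eq_zero_of_abs_variation {p w c : ℝ}
    (h : ∀ t, 0 ≤ t * (p - w) + t ^ 2 / 2 + c * (|p + t| - |p|)) (hw : |w| < c) : p = 0 := by
  by_contra hp
  have h1 := h (-p)
  have hpos : 0 < |p| := abs_pos.mpr hp
  have h2 : p * w ≤ |p| * |w| := by rw [← abs_mul]; exact le_abs_self _
  have h3 : |p| * |w| < |p| * c := mul_lt_mul_of_pos_left hw hpos
  simp only [add_neg_cancel, abs_zero] at h1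
  nlinarith [sq_nonneg p]

/-- Stationarity of a positive minimizer of `z ↦ (z - w)² / 2 + c |z|`. -/
lemma stationary_of_abs_variation_of_pos {p w c : ℝ}
    (h : ∀ t, 0 ≤ t * (p - w) + t ^ 2 / 2 + c * (|p + t| - |p|)) (hp : 0 < p) :
    p - w + c = 0 := by
  by_contra hD
  set D := p - w + c with hDdef
  have hDpos : 0 < |D| := abs_pos.mpr hD
  obtain ⟨s, hs0, hs1, hsD⟩ : ∃ s : ℝ, 0 < s ∧ s ≤ 1 ∧ s * |D| ≤ p :=
    ⟨min 1 (p / |D|), lt_min one_pos (div_pos hp hDpos), min_le_left _ _,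
      (le_div_iff₀ hDpos).mp (min_le_right _ _)⟩
  have h1 := h (-(s * D))
  have hle : s * D ≤ p := (mul_le_mul_of_nonneg_left (le_abs_self D) hs0.le).trans hsD
  rw [abs_of_nonneg (by linarith : 0 ≤ p + -(s * D)), abs_of_pos hp] at h1
  have hD2 : 0 < s * D ^ 2 := by positivity
  have h2 : s * (s * D ^ 2) ≤ 1 * (s * D ^ 2) := mul_le_mul_of_nonneg_right hs1 hD2.le
  have h3 : -(s * D) * (p - w) + (-(s * D)) ^ 2 / 2 + c * (p + -(s * D) - p)
      = -(s * D ^ 2) + s * (s * D ^ 2) / 2 := by rw [hDdef]; ring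
  linarith

/-- Stationarity of a nonzero minimizer of `z ↦ (z - w)² / 2 + c |z|`. -/
lemma stationary_of_abs_variation {p w c : ℝ}
    (h : ∀ t, 0 ≤ t * (p - w) + t ^ 2 / 2 + c * (|p + t| - |p|)) (hp : p ≠ 0) :
    p - w + c * Real.sign p = 0 := by
  rcases hp.lt_or_gt with hneg | hpos
  · have := stationary_of_abs_variation_of_pos (p := -p) (w := -w) (c := c) (fun t => by
      have := h (-t)
      rw [show -p + t = -(p + -t) by ring, abs_neg, abs_neg]
      linarith) (by linarith)
    rw [Real.sign_of_neg hneg]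
    linarith
  · rw [Real.sign_of_pos hpos, mul_one]
    exact stationary_of_abs_variation_of_pos h hpos

/-- The sign of a real sequence stabilizes when the limit is nonzero. -/
lemma eventually_ne_zero_and_sign_eq {α : Type*} {l : Filter α} {f : α → ℝ} {c : ℝ}
    (hf : Tendsto f l (nhds c)) (hc : c ≠ 0) :
    ∀ᶠ k in l, f k ≠ 0 ∧ Real.sign (f k) = Real.sign c := by
  rcases hc.lt_or_gt with hneg | hpos
  · filter_upwards [hf.eventually_lt_const hneg] with k hk
    exact ⟨hk.ne, by rw [Real.sign_of_neg hk, Real.sign_of_neg hneg]⟩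
  · filter_upwards [hf.eventually_const_lt hpos] with k hk
    exact ⟨hk.ne', by rw [Real.sign_of_pos hk, Real.sign_of_pos hpos]⟩

/-- A step `d ↦ e` which is the compression of `1 - g A*A` to a subspace `T` contracts by the
bound `q` on the quadratic form of `1 - g A*A` on `T`. -/
lemma norm_le_of_abs_quadratic_form_le {E F : Type*}
    [NormedAddCommGroup E] [InnerProductSpace ℝ E]
    [NormedAddCommGroup F] [InnerProductSpace ℝ F] (A : E →L[ℝ] F) (T : Submodule ℝ E)
    {g q : ℝ} (hq : ∀ u ∈ T, |‖u‖ ^ 2 - g * ‖A u‖ ^ 2| ≤ q * ‖u‖ ^ 2) {d e : E}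
    (hd : d ∈ T) (he : e ∈ T) (hde : ‖e‖ ^ 2 = ⟪e, d⟫ - g * ⟪A e, A d⟫) :
    ‖e‖ ≤ q * ‖d‖ := by
  by_cases hd0 : d = 0
  · subst hd0
    simpa using hde
  by_cases he0 : e = 0
  · subst he0
    have h1 := (abs_nonneg _).trans (hq d hd)
    have hdpos : 0 < ‖d‖ := norm_pos_iff.mpr hd0
    have h2 : 0 ≤ q := nonneg_of_mul_nonneg_left h1 (by positivity)
    rw [norm_zero]
    positivity
  have hdpos : 0 < ‖d‖ := norm_pos_iff.mpr hd0
  have hepos : 0 < ‖e‖ := norm_pos_iff.mpr he0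
  have hu : ‖d‖ • e ∈ T := T.smul_mem _ he
  have hv : ‖e‖ • d ∈ T := T.smul_mem _ hd
  have hadd := (abs_le.mp (hq _ (T.add_mem hu hv))).2
  have hsub := (abs_le.mp (hq _ (T.sub_mem hu hv))).1
  simp only [map_add, map_sub, map_smul, norm_add_sq_real, norm_sub_sq_real, norm_smul,
    norm_norm, real_inner_smul_left, real_inner_smul_right] at hadd hsub
  have key : ‖d‖ * ‖e‖ * ‖e‖ ^ 2 ≤ q * (‖d‖ ^ 2 * ‖e‖ ^ 2) := by
    have hmul := congrArg (‖d‖ * ‖e‖ * ·) hde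
    linarith
  have hfac : 0 < ‖d‖ * ‖e‖ ^ 2 := by positivity
  refine le_of_mul_le_mul_left ?_ hfac
  linarith

/-- If `σm ≤ ‖Au‖² / ‖u‖² ≤ σM` then the quadratic form of `1 - g A*A` at `u` is bounded by the
larger of `|1 - g σm|` and `|1 - g σM|`. -/
lemma abs_sub_mul_le_max_mul {g σm σM r s : ℝ} (hg : 0 ≤ g) (hr : 0 ≤ r)
    (hm : σm * r ≤ s) (hM : s ≤ σM * r) :
    |r - g * s| ≤ max |1 - g * σm| |1 - g * σM| * r := by
  have h1 := mul_le_mul_of_nonneg_left hm hg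
  have h2 := mul_le_mul_of_nonneg_left hM hg
  have h3 := mul_le_mul_of_nonneg_right
    ((le_abs_self (1 - g * σm)).trans (le_max_left _ |1 - g * σM|)) hr
  have h4 := mul_le_mul_of_nonneg_right
    ((neg_le_abs (1 - g * σM)).trans (le_max_right |1 - g * σm| _)) hr
  rw [abs_le]
  constructor <;> linarith

/-- Local linear convergence of Forward–Backward for the Lasso under the
non-degeneracy and restricted injectivity conditions. -/
theorem lasso_local_linear_convergence {n m : ℕ}
    (A : EuclideanSpace ℝ (Fin n) →L[ℝ] EuclideanSpace ℝ (Fin m))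
    (y : EuclideanSpace ℝ (Fin m)) (lam : ℝ) (hlam : 0 < lam)
    (a b : ℝ) (ha : 0 < a) (hab : a ≤ b)
    (hb : b < 2 / ‖(ContinuousLinearMap.adjoint A).comp A‖)
    (γ : ℕ → ℝ) (hγ : ∀ k, γ k ∈ Set.Icc a b)
    (x : ℕ → EuclideanSpace ℝ (Fin n))
    (hrec : ∀ k, IsProx (γ k) (fun z => lam * ∑ i, |z i|)
      (x k - γ k • (ContinuousLinearMap.adjoint A) (A (x k) - y)) (x (k+1)))
    (xstar : EuclideanSpace ℝ (Fin n))
    (hmin : IsMinOn (fun z => (1/2) * ‖A z - y‖ ^ 2 + lam * ∑ i, |z i|) Set.univ xstar)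
    (hlim : Filter.Tendsto x Filter.atTop (nhds xstar))
    (hnd : ∀ i, xstar i = 0 → |(ContinuousLinearMap.adjoint A (A xstar - y)) i| < lam)
    (hinj : ∀ u : EuclideanSpace ℝ (Fin n),
      A u = 0 → (∀ i, xstar i = 0 → u i = 0) → u = 0)
    (σm σM : ℝ) (hσm : 0 < σm)
    (hlb : ∀ u : EuclideanSpace ℝ (Fin n),
      (∀ i, xstar i = 0 → u i = 0) → σm * ‖u‖ ^ 2 ≤ ‖A u‖ ^ 2)
    (hub : ∀ u : EuclideanSpace ℝ (Fin n),
      (∀ i, xstar i = 0 → u i = 0) → ‖A u‖ ^ 2 ≤ σM * ‖u‖ ^ 2) :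
    ∃ K : ℕ, ∀ k ≥ K, ‖x (k+1) - xstar‖ ≤
      max |1 - γ k * σm| |1 - γ k * σM| * ‖x k - xstar‖ := by
  set G : EuclideanSpace ℝ (Fin n) → EuclideanSpace ℝ (Fin n) :=
    fun z => ContinuousLinearMap.adjoint A (A z - y) with hG
  have hvar : ∀ k i t, 0 ≤ t * (x (k + 1) i - (x k i - γ k * G (x k) i)) + t ^ 2 / 2
      + γ k * lam * (|x (k + 1) i + t| - |x (k + 1) i|) :=
    fun k i t => (hrec k).coordinate_variation i t
  have hγpos : ∀ k, 0 < γ k := fun k => ha.trans_le (hγ k).1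
  have hx : ∀ i, Tendsto (fun k => x k i) atTop (nhds (xstar i)) := fun i =>
    ((EuclideanSpace.proj (𝕜 := ℝ) i).continuous.tendsto xstar).comp hlim
  have hGx : ∀ i, Tendsto (fun k => G (x k) i) atTop (nhds (G xstar i)) := fun i => by
    have hcont : Continuous fun z => G z i :=
      (EuclideanSpace.proj (𝕜 := ℝ) i).continuous.comp
        ((ContinuousLinearMap.adjoint A).continuous.comp (A.continuous.sub continuous_const))
    exact (hcont.tendsto xstar).comp hlim
  have hoff : ∀ i, xstar i = 0 → ∀ᶠ k in atTop, x (k + 1) i = 0 := by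
    intro i hi
    have hlim' : Tendsto (fun k => |x k i| / a + |G (x k) i|) atTop (nhds |G xstar i|) := by
      simpa [hi] using ((hx i).abs.div_const a).add (hGx i).abs
    filter_upwards [hlim'.eventually_lt_const (hnd i hi)] with k hk
    refine eq_zero_of_abs_variation (hvar k i) ?_
    have h1 : |x k i| ≤ γ k * (|x k i| / a) := by
      have : a * (|x k i| / a) ≤ γ k * (|x k i| / a) := by
        gcongr
        exact (hγ k).1
      rwa [mul_div_cancel₀ _ ha.ne'] at this
    calc |x k i - γ k * G (x k) i| ≤ |x k i| + γ k * |G (x k) i| := by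
          refine (abs_sub _ _).trans_eq ?_
          rw [abs_mul, abs_of_pos (hγpos k)]
      _ ≤ γ k * (|x k i| / a + |G (x k) i|) := by linarith
      _ < γ k * lam := mul_lt_mul_of_pos_left hk (hγpos k)
  have hon : ∀ i, xstar i ≠ 0 → ∀ᶠ k in atTop,
      x (k + 1) i - x k i + γ k * (G (x k) i + lam * Real.sign (xstar i)) = 0 := by
    intro i hi
    filter_upwards [(tendsto_add_atTop_nat 1).eventually
      (eventually_ne_zero_and_sign_eq (hx i) hi)] with k hk
    have h1 := stationary_of_abs_variation (hvar k i) hk.1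
    rw [hk.2] at h1
    linarith
  have hstar : ∀ i, xstar i ≠ 0 → G xstar i + lam * Real.sign (xstar i) = 0 := by
    intro i hi
    have hL : Tendsto (fun k => a * |G (x k) i + lam * Real.sign (xstar i)|) atTop
        (nhds (a * |G xstar i + lam * Real.sign (xstar i)|)) :=
      ((hGx i).add_const _).abs.const_mul a
    have hR : Tendsto (fun k => |x (k + 1) i - x k i|) atTop (nhds 0) := by
      simpa using (((hx i).comp (tendsto_add_atTop_nat 1)).sub (hx i)).abs
    have hle := le_of_tendsto_of_tendsto hL hR <| (hon i hi).mono fun k hk => by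
      beta_reduce
      rw [eq_neg_of_add_eq_zero_left hk, abs_neg, abs_mul, abs_of_pos (hγpos k)]
      exact mul_le_mul_of_nonneg_right (hγ k).1 (abs_nonneg _)
    exact abs_nonpos_iff.mp (nonpos_of_mul_nonpos_right hle ha)
  let T : Submodule ℝ (EuclideanSpace ℝ (Fin n)) :=
    { carrier := {u | ∀ i, xstar i = 0 → u i = 0}
      add_mem' := fun hu hv i hi => by simp [hu i hi, hv i hi]
      zero_mem' := fun i _ => by simp
      smul_mem' := fun c u hu i hi => by simp [hu i hi] }
  have hT : ∀ᶠ k in atTop, x (k + 1) - xstar ∈ T := by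
    have h : ∀ᶠ k in atTop, ∀ i, xstar i = 0 → x (k + 1) i = 0 :=
      eventually_all.mpr fun i => eventually_imp_distrib_left.mpr (hoff i)
    filter_upwards [h] with k hk i hi
    simp [hk i hi, hi]
  have hT' : ∀ᶠ k in atTop, x k - xstar ∈ T := by
    rw [← map_add_atTop_eq_nat 1]
    exact hT
  have hon' : ∀ᶠ k in atTop, ∀ i, xstar i ≠ 0 →
      x (k + 1) i - x k i + γ k * (G (x k) i + lam * Real.sign (xstar i)) = 0 :=
    eventually_all.mpr fun i => eventually_imp_distrib_left.mpr (hon i)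
  refine eventually_atTop.mp ?_
  filter_upwards [hT, hT', hon'] with k he hd hstep
  refine norm_le_of_abs_quadratic_form_le A T (g := γ k) (fun u hu =>
    abs_sub_mul_le_max_mul (hγpos k).le (sq_nonneg _) (hlb u hu) (hub u hu)) hd he ?_
  have hGsub : G (x k) - G xstar = ContinuousLinearMap.adjoint A (A (x k - xstar)) := by
    simp only [hG, ← map_sub]
    congr 1
    rw [map_sub]
    abel
  rw [← ContinuousLinearMap.adjoint_inner_right, ← hGsub, ← real_inner_self_eq_norm_sq,
    ← real_inner_smul_right, ← inner_sub_right, PiLp.inner_apply, PiLp.inner_apply]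
  refine Finset.sum_congr rfl fun i _ => ?_
  by_cases hi : xstar i = 0
  · rw [he i hi]
    simp
  · congr 1
    have h1 := hstep i hi
    have h2 := hstar i hi
    simp only [PiLp.sub_apply, PiLp.smul_apply, smul_eq_mul]
    linear_combination h1 - γ k * h2
end
end
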